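/- Let L(λ) := M_{τ_1}(Y_1) M_{σ_1}(X_1) (λ M_τ^P − M_σ^P) M_{σ_2}(X_2) M_{τ_2}(Y_2) be an extended generalized Fiedler pencil (EGFP) of P(λ). If all the matrix assignments X_1, X_2, Y_1, Y_2 are nonsingular, then L(λ) is a strong linearization of P(λ). -/

import Mathlib

open Matrix Polynomial

/-- Signed indices: `pos k` denotes `k` and `neg k` denotes `−k`, with `−0` and `0` distinct. -/
inductive SIdx : Type where
  | pos : ℕ → SIdx
  | neg : ℕ → SIdx
deriving DecidableEq

namespace SIdx

/-- The absolute value of a signed index. -/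
def val : SIdx → ℕ
  | pos k => k
  | neg k => k

/-- Whether a signed index is negative. -/
def isNeg : SIdx → Bool
  | pos _ => false
  | neg _ => true

/-- The successor `t + 1` of a signed index (`−s + 1 = −(s−1)`). -/
def succ : SIdx → SIdx
  | pos k => pos (k + 1)
  | neg 0 => pos 0
  | neg (k + 1) => neg k

/-- Negation of a signed index. -/
def negate : SIdx → SIdx
  | pos k => neg k
  | neg k => pos k

end SIdx

/-- The ascending chain `(t, t+1, …, t+p)`. -/
def chainUp (t : SIdx) : ℕ → List SIdx
  | 0 => [t]
  | p + 1 => t :: chainUp t.succ p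

/-- The number of consecutions `c_t(α)` of the index tuple `α` at `t` (`−1` when `t ∉ α`):
the largest `p` such that `(t, t+1, …, t+p)` is a subtuple (sublist) of `α`. -/
noncomputable def consAt (α : List SIdx) (t : SIdx) : ℤ :=
  letI := Classical.decPred (fun p : ℕ => (chainUp t p).Sublist α)
  if t ∈ α then (Nat.findGreatest (fun p : ℕ => (chainUp t p).Sublist α) α.length : ℤ) else -1

/-- The number of inversions `i_t(α)` of the index tuple `α` at `t` (`−1` when `t ∉ α`):
the largest `q` such that `(t+q, …, t+1, t)` is a subtuple (sublist) of `α`. -/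
noncomputable def invsAt (α : List SIdx) (t : SIdx) : ℤ :=
  letI := Classical.decPred (fun p : ℕ => ((chainUp t p).reverse).Sublist α)
  if t ∈ α then (Nat.findGreatest (fun p : ℕ => ((chainUp t p).reverse).Sublist α) α.length : ℤ)
  else -1

/-- The Successor Infix Property: between any two equal entries there is an occurrence of
their successor. -/
def SIP (α : List SIdx) : Prop :=
  ∀ a b : Fin α.length, a < b → α.get a = α.get b →
    ∃ c : Fin α.length, a < c ∧ c < b ∧ α.get c = (α.get a).succ

/-- The `mn × mn` elementary matrix `M_k(X)` (viewed as an `m × m` block matrix with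
`n × n` blocks): `M_0(X) = M_{−0}(X) = diag(I_{(m−1)n}, X)`,
`M_m(X) = M_{−m}(X) = diag(X, I_{(m−1)n})`, and for `1 ≤ i ≤ m−1` the matrix `M_i(X)`
(resp. `M_{−i}(X)`) is the identity except for the 2×2 block submatrix
`[[X, I],[I, 0]]` (resp. `[[0, I],[I, X]]`) in block rows/columns `(m−i, m−i+1)`
(1-indexed). -/
noncomputable def elemMat (m n : ℕ) (k : SIdx) (X : Matrix (Fin n) (Fin n) ℂ) :
    Matrix (Fin m × Fin n) (Fin m × Fin n) ℂ := fun p q =>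
  if k.val = 0 then
    if p.1 = q.1 then (if (p.1 : ℕ) = m - 1 then X p.2 q.2 else if p.2 = q.2 then 1 else 0)
    else 0
  else if k.val = m then
    if p.1 = q.1 then (if (p.1 : ℕ) = 0 then X p.2 q.2 else if p.2 = q.2 then 1 else 0)
    else 0
  else
    if (p.1 : ℕ) = m - k.val - 1 ∧ (q.1 : ℕ) = m - k.val - 1 then
      (if k.isNeg then 0 else X p.2 q.2)
    else if ((p.1 : ℕ) = m - k.val - 1 ∧ (q.1 : ℕ) = m - k.val) ∨
        ((p.1 : ℕ) = m - k.val ∧ (q.1 : ℕ) = m - k.val - 1) then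
      (if p.2 = q.2 then 1 else 0)
    else if (p.1 : ℕ) = m - k.val ∧ (q.1 : ℕ) = m - k.val then
      (if k.isNeg then X p.2 q.2 else 0)
    else if p = q then 1 else 0

/-- `M_t(X) = M_{t_1}(X_1) ⋯ M_{t_r}(X_r)` for an index tuple `t` with matrix assignment `Xs`. -/
noncomputable def prodAssign (m n : ℕ) (t : List SIdx) (Xs : List (Matrix (Fin n) (Fin n) ℂ)) :
    Matrix (Fin m × Fin n) (Fin m × Fin n) ℂ :=
  ((t.zip Xs).map fun p => elemMat m n p.1 p.2).prod

/-- The trivial (Fiedler) matrix assignment of `P(λ) = Σ λ^i A_i`: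
`M_i^P = M_i(−A_i)` for `0 ≤ i ≤ m−1`, `M_m^P = (M_{−m}^P)⁻¹ = M_m(A_m⁻¹)`,
`M_{−i}^P = M_{−i}(A_i)` for `1 ≤ i ≤ m`, and `M_{−0}^P = (M_0^P)⁻¹ = M_{−0}((−A_0)⁻¹)`. -/
noncomputable def fiedlerX (m : ℕ) {n : ℕ} (A : ℕ → Matrix (Fin n) (Fin n) ℂ) :
    SIdx → Matrix (Fin n) (Fin n) ℂ
  | .pos i => if i = m then (A m)⁻¹ else -A i
  | .neg i => if i = 0 then (-A 0)⁻¹ else A i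

/-- `M_t^P`, the product of Fiedler matrices of `P` along the index tuple `t`. -/
noncomputable def prodFiedler (m n : ℕ) (A : ℕ → Matrix (Fin n) (Fin n) ℂ) (t : List SIdx) :
    Matrix (Fin m × Fin n) (Fin m × Fin n) ℂ :=
  (t.map fun k => elemMat m n k (fiedlerX m A k)).prod

/-- A nonsingular matrix assignment: the matrices assigned to positions with indices
`±0` or `±m` are nonsingular. -/
def NonsingAssign (m : ℕ) {n : ℕ} (t : List SIdx) (Xs : List (Matrix (Fin n) (Fin n) ℂ)) :
    Prop :=
  t.length = Xs.length ∧ ∀ p ∈ t.zip Xs, (p.1.val = 0 ∨ p.1.val = m) → IsUnit p.2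

/-- The data of an extended generalized Fiedler pencil (EGFP)
`L(λ) = M_{τ₁}(Y₁) M_{σ₁}(X₁) (λ M_τ^P − M_σ^P) M_{σ₂}(X₂) M_{τ₂}(Y₂)`
of the `n × n` matrix polynomial `P(λ) = Σ_{i=0}^m λ^i A_i` of degree `m ≥ 2`. -/
structure EGFPData (m n : ℕ) where
  /-- coefficients of `P` -/
  A : ℕ → Matrix (Fin n) (Fin n) ℂ
  sig : List SIdx
  tau : List SIdx
  sig1 : List SIdx
  sig2 : List SIdx
  tau1 : List SIdx
  tau2 : List SIdx
  X1 : List (Matrix (Fin n) (Fin n) ℂ)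
  X2 : List (Matrix (Fin n) (Fin n) ℂ)
  Y1 : List (Matrix (Fin n) (Fin n) ℂ)
  Y2 : List (Matrix (Fin n) (Fin n) ℂ)
  hm : 2 ≤ m
  hAm : A m ≠ 0
  hsigpos : ∀ k ∈ sig, k.isNeg = false
  htauneg : ∀ k ∈ tau, k.isNeg = true
  /-- `(σ, ω)` is a permutation of `{0, 1, …, m}`, where `τ = −ω`. -/
  hperm : List.Perm (sig.map SIdx.val ++ tau.map SIdx.val) (List.range (m + 1))
  hsig1 : ∀ k ∈ sig1, k ∈ sig ∧ k.val + 2 ≤ m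
  hsig2 : ∀ k ∈ sig2, k ∈ sig ∧ k.val + 2 ≤ m
  htau1 : ∀ k ∈ tau1, k ∈ tau ∧ 2 ≤ k.val
  htau2 : ∀ k ∈ tau2, k ∈ tau ∧ 2 ≤ k.val
  hSIPsig : SIP (sig1 ++ sig ++ sig2)
  hSIPtau : SIP (tau1 ++ tau ++ tau2)
  hX1 : NonsingAssign m sig1 X1
  hX2 : NonsingAssign m sig2 X2
  hY1 : NonsingAssign m tau1 Y1
  hY2 : NonsingAssign m tau2 Y2
  hA0 : SIdx.neg 0 ∈ tau → IsUnit (A 0)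
  hAmUnit : SIdx.pos m ∈ sig → IsUnit (A m)

namespace EGFPData

variable {m n : ℕ}

/-- `M_{τ₁}(Y₁) M_{σ₁}(X₁)`. -/
noncomputable def leftFac (E : EGFPData m n) : Matrix (Fin m × Fin n) (Fin m × Fin n) ℂ :=
  prodAssign m n E.tau1 E.Y1 * prodAssign m n E.sig1 E.X1

/-- `M_{σ₂}(X₂) M_{τ₂}(Y₂)`. -/
noncomputable def rightFac (E : EGFPData m n) : Matrix (Fin m × Fin n) (Fin m × Fin n) ℂ :=
  prodAssign m n E.sig2 E.X2 * prodAssign m n E.tau2 E.Y2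

/-- The coefficient `L₁` of `λ` in `L(λ) = λ L₁ − L₀`. -/
noncomputable def L1 (E : EGFPData m n) : Matrix (Fin m × Fin n) (Fin m × Fin n) ℂ :=
  E.leftFac * prodFiedler m n E.A E.tau * E.rightFac

/-- The constant term `L₀` in `L(λ) = λ L₁ − L₀`. -/
noncomputable def L0 (E : EGFPData m n) : Matrix (Fin m × Fin n) (Fin m × Fin n) ℂ :=
  E.leftFac * prodFiedler m n E.A E.sig * E.rightFac

end EGFPData

/-- The `(i, j)` block (of size `n × n`) of an `mn × mn` matrix. -/
def blockOf {m n : ℕ} (M : Matrix (Fin m × Fin n) (Fin m × Fin n) ℂ) (i j : Fin m) :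
    Matrix (Fin n) (Fin n) ℂ := fun p q => M (i, p) (j, q)

/-- Block penta-diagonal: all blocks `B_{ij}` with `|i − j| > 2` vanish. -/
def BlockPenta {m n : ℕ} (M : Matrix (Fin m × Fin n) (Fin m × Fin n) ℂ) : Prop :=
  ∀ i j : Fin m, ((i : ℕ) + 2 < (j : ℕ) ∨ (j : ℕ) + 2 < (i : ℕ)) → blockOf M i j = 0

/-- Block tridiagonal: all blocks `B_{ij}` with `|i − j| > 1` vanish. -/
def BlockTri {m n : ℕ} (M : Matrix (Fin m × Fin n) (Fin m × Fin n) ℂ) : Prop :=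
  ∀ i j : Fin m, ((i : ℕ) + 1 < (j : ℕ) ∨ (j : ℕ) + 1 < (i : ℕ)) → blockOf M i j = 0

/-- `e_j^T ⊗ I_n` as an `n × mn` matrix, for a 1-indexed block index `j`
(zero when `j` is out of range). -/
def rowSel (m n : ℕ) (j : ℤ) : Matrix (Fin n) (Fin m × Fin n) ℂ :=
  fun p q => if ((q.1 : ℕ) : ℤ) + 1 = j ∧ p = q.2 then 1 else 0

/-- `e_j ⊗ I_n` as an `mn × n` matrix, for a 1-indexed block index `j`
(zero when `j` is out of range). -/
def colSel (m n : ℕ) (j : ℤ) : Matrix (Fin m × Fin n) (Fin n) ℂ :=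
  fun p q => if ((p.1 : ℕ) : ℤ) + 1 = j ∧ p.2 = q then 1 else 0

/-- The matrix polynomial `P(λ) = Σ_{i=0}^m λ^i A_i` as an `n × n` matrix over `ℂ[λ]`. -/
noncomputable def polyP (m n : ℕ) (A : ℕ → Matrix (Fin n) (Fin n) ℂ) :
    Matrix (Fin n) (Fin n) (Polynomial ℂ) := fun p q =>
  ∑ i ∈ Finset.range (m + 1), Polynomial.C (A i p q) * Polynomial.X ^ i

/-- The pencil `λ M₁ − M₀` as a matrix over `ℂ[λ]`. -/
noncomputable def pencilPoly {N : Type*} (M1 M0 : Matrix N N ℂ) : Matrix N N (Polynomial ℂ) :=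
  fun p q => Polynomial.C (M1 p q) * Polynomial.X - Polynomial.C (M0 p q)

/-- The reversal `rev L(λ) = M₁ − λ M₀` of the pencil `λ M₁ − M₀`. -/
noncomputable def revPencilPoly {N : Type*} (M1 M0 : Matrix N N ℂ) :
    Matrix N N (Polynomial ℂ) :=
  fun p q => Polynomial.C (M1 p q) - Polynomial.C (M0 p q) * Polynomial.X

/-- `rev P(λ) = λ^m P(1/λ) = Σ_{i=0}^m λ^{m−i} A_i`. -/
noncomputable def revPolyP (m n : ℕ) (A : ℕ → Matrix (Fin n) (Fin n) ℂ) :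
    Matrix (Fin n) (Fin n) (Polynomial ℂ) := fun p q =>
  ∑ i ∈ Finset.range (m + 1), Polynomial.C (A i p q) * Polynomial.X ^ (m - i)

/-- `diag(I_{(m−1)n}, Q)` as an `mn × mn` matrix over `ℂ[λ]`. -/
noncomputable def lastBlockDiag (m n : ℕ) (Q : Matrix (Fin n) (Fin n) (Polynomial ℂ)) :
    Matrix (Fin m × Fin n) (Fin m × Fin n) (Polynomial ℂ) := fun p q =>
  if (p.1 : ℕ) = m - 1 ∧ (q.1 : ℕ) = m - 1 then Q p.2 q.2 else if p = q then 1 else 0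

/-- `Lp` is a linearization of the `n × n` matrix polynomial `Q`: there are unimodular
matrix polynomials `U, V` with `U · Lp · V = diag(I_{(m−1)n}, Q)`. -/
def IsLinearization {m n : ℕ} (Lp : Matrix (Fin m × Fin n) (Fin m × Fin n) (Polynomial ℂ))
    (Q : Matrix (Fin n) (Fin n) (Polynomial ℂ)) : Prop :=
  ∃ U V : Matrix (Fin m × Fin n) (Fin m × Fin n) (Polynomial ℂ),
    IsUnit U.det ∧ IsUnit V.det ∧ U * Lp * V = lastBlockDiag m n Q

section EGFPProof

namespace EGFPProof

open SIdx

/-- block elementary matrix over an arbitrary ring. -/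
def eM {S : Type*} [Ring S] (m : ℕ) (k : SIdx) (X : S) : Matrix (Fin m) (Fin m) S := fun p q =>
  if k.val = 0 then
    if p = q then (if (p : ℕ) = m - 1 then X else 1) else 0
  else if k.val = m then
    if p = q then (if (p : ℕ) = 0 then X else 1) else 0
  else
    if (p : ℕ) = m - k.val - 1 ∧ (q : ℕ) = m - k.val - 1 then
      (if k.isNeg then 0 else X)
    else if ((p : ℕ) = m - k.val - 1 ∧ (q : ℕ) = m - k.val) ∨
        ((p : ℕ) = m - k.val ∧ (q : ℕ) = m - k.val - 1) then 1
    else if (p : ℕ) = m - k.val ∧ (q : ℕ) = m - k.val then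
      (if k.isNeg then X else 0)
    else if p = q then 1 else 0

def lbd {S : Type*} [Ring S] (m : ℕ) (Q : S) : Matrix (Fin m) (Fin m) S := fun p q =>
  if (p : ℕ) = m - 1 ∧ (q : ℕ) = m - 1 then Q else if p = q then 1 else 0

/-- bordered matrix -/
def bord {S : Type*} {k : ℕ} (a : S) (r c : Fin k → S) (W : Matrix (Fin k) (Fin k) S) :
    Matrix (Fin (k + 1)) (Fin (k + 1)) S := fun i j =>
  Fin.cases (Fin.cases a r j) (fun i' => Fin.cases (c i') (fun j' => W i' j') j) i

section bordlemmas
variable {S : Type*} [Ring S] {k : ℕ}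

@[simp] lemma bord_zz (a : S) (r c : Fin k → S) (W : Matrix (Fin k) (Fin k) S) :
    bord a r c W 0 0 = a := rfl
@[simp] lemma bord_zs (a : S) (r c : Fin k → S) (W : Matrix (Fin k) (Fin k) S) (j : Fin k) :
    bord a r c W 0 j.succ = r j := rfl
@[simp] lemma bord_sz (a : S) (r c : Fin k → S) (W : Matrix (Fin k) (Fin k) S) (i : Fin k) :
    bord a r c W i.succ 0 = c i := rfl
@[simp] lemma bord_ss (a : S) (r c : Fin k → S) (W : Matrix (Fin k) (Fin k) S) (i j : Fin k) :
    bord a r c W i.succ j.succ = W i j := rfl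

lemma bord_ext {M N : Matrix (Fin (k + 1)) (Fin (k + 1)) S} (h0 : M 0 0 = N 0 0)
    (h1 : ∀ j : Fin k, M 0 j.succ = N 0 j.succ) (h2 : ∀ j : Fin k, M j.succ 0 = N j.succ 0)
    (h3 : ∀ i j : Fin k, M i.succ j.succ = N i.succ j.succ) : M = N := by
  ext i j
  refine Fin.cases ?_ (fun i => ?_) i <;> refine Fin.cases ?_ (fun j => ?_) j
  · exact h0
  · exact h1 j
  · exact h2 i
  · exact h3 i j

lemma bord_mul (a a' : S) (r c r' c' : Fin k → S) (W W' : Matrix (Fin k) (Fin k) S) :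
    bord a r c W * bord a' r' c' W' =
      bord (a * a' + r ⬝ᵥ c') (fun j => a * r' j + (r ᵥ* W') j)
        (fun i => c i * a' + (W *ᵥ c') i) (Matrix.vecMulVec c r' + W * W') := by
  apply bord_ext <;> intros <;>
    simp [Matrix.mul_apply, Fin.sum_univ_succ, dotProduct, Matrix.vecMul, Matrix.mulVec,
      Matrix.vecMulVec_apply]

lemma bord_one : bord (1 : S) 0 0 (1 : Matrix (Fin k) (Fin k) S) = 1 := by
  apply bord_ext <;> intros <;> simp [Matrix.one_apply, Fin.succ_ne_zero, (Fin.succ_ne_zero _).symm]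

lemma bord_bord_one : bord (1 : S) 0 0 (bord 1 0 0 (1 : Matrix (Fin k) (Fin k) S)) = 1 := by
  rw [bord_one, bord_one]

lemma bord_sub (a a' : S) (r c r' c' : Fin k → S) (W W' : Matrix (Fin k) (Fin k) S) :
    bord a r c W - bord a' r' c' W' = bord (a - a') (r - r') (c - c') (W - W') := by
  apply bord_ext <;> intros <;> simp

lemma bord_smul {R : Type*} [SMul R S] (t : R) (a : S) (r c : Fin k → S)
    (W : Matrix (Fin k) (Fin k) S) :
    t • bord a r c W = bord (t • a) (t • r) (t • c) (t • W) := by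
  apply bord_ext <;> intros <;> simp

/-- `1 ⊕ W` -/
def iota (W : Matrix (Fin k) (Fin k) S) : Matrix (Fin (k + 1)) (Fin (k + 1)) S := bord 1 0 0 W

lemma iota_mul (W W' : Matrix (Fin k) (Fin k) S) : iota (W * W') = iota W * iota W' := by
  unfold iota
  rw [bord_mul]
  apply bord_ext <;> intros <;> simp [Matrix.vecMulVec_apply]

lemma iota_one : iota (1 : Matrix (Fin k) (Fin k) S) = 1 := bord_one

lemma iota_prod (l : List (Matrix (Fin k) (Fin k) S)) : (l.map iota).prod = iota l.prod := by
  induction l with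
  | nil => simp [iota_one]
  | cons a l ih => simp [ih, iota_mul]

lemma eM_iota (m : ℕ) (i : SIdx) (X : S) (h : i.val < m) : eM (m + 1) i X = iota (eM m i X) := by
  rcases Nat.eq_zero_or_pos i.val with hv | hv
  · obtain ⟨d, rfl⟩ : ∃ d, m = d + 1 := ⟨m - 1, by omega⟩
    apply bord_ext <;> intros <;> simp only [iota, bord_zz, bord_zs, bord_sz, bord_ss, eM, hv,
      Fin.ext_iff, Fin.val_zero, Fin.val_succ, Pi.zero_apply] <;> grind
  · obtain ⟨d, hd⟩ : ∃ d, m = i.val + d + 1 := ⟨m - i.val - 1, by omega⟩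
    have h1 : i.val ≠ 0 := by omega
    have h2 : i.val ≠ m := by omega
    have h3 : i.val ≠ m + 1 := by omega
    have h4 : m + 1 - i.val - 1 = d + 1 := by omega
    have h5 : m + 1 - i.val = d + 2 := by omega
    have h6 : m - i.val - 1 = d := by omega
    have h7 : m - i.val = d + 1 := by omega
    apply bord_ext <;> intros <;> simp only [iota, bord_zz, bord_zs, bord_sz, bord_ss, eM,
      h1, h2, h3, h4, h5, h6, h7, if_false,
      Fin.ext_iff, Fin.val_zero, Fin.val_succ, Pi.zero_apply] <;> grind

lemma eM_top (m : ℕ) (i : SIdx) (X : S) (h : i.val = m + 1) : eM (m + 1) i X = bord X 0 0 1 := by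
  apply bord_ext <;> intros <;> simp only [bord_zz, bord_zs, bord_sz, bord_ss, eM,
    Fin.ext_iff, Fin.val_zero, Fin.val_succ, Pi.zero_apply, Matrix.one_apply] <;> grind

lemma eM_zero (i : SIdx) (X : S) (h : i.val = 0) : eM 1 i X = bord X 0 0 1 := by
  apply bord_ext <;> intros <;> simp only [bord_zz, bord_zs, bord_sz, bord_ss, eM,
    Fin.ext_iff, Fin.val_zero, Fin.val_succ, Pi.zero_apply, Matrix.one_apply] <;> grind

lemma eM_pos (m : ℕ) (X : S) :
    eM (m + 2) (pos (m + 1)) X = bord X (Pi.single 0 1) (Pi.single 0 1) (bord 0 0 0 1) := by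
  apply bord_ext
  · simp [eM, SIdx.val, isNeg]
  · intro j; refine Fin.cases ?_ (fun j => ?_) j <;> simp [-Fin.succ_zero_eq_one, -Fin.succ_zero_eq_one', eM, SIdx.val, isNeg, Fin.ext_iff]
  · intro j; refine Fin.cases ?_ (fun j => ?_) j <;> simp [-Fin.succ_zero_eq_one, -Fin.succ_zero_eq_one', eM, SIdx.val, isNeg, Fin.ext_iff]
  · intro i j; refine Fin.cases ?_ (fun i => ?_) i <;> refine Fin.cases ?_ (fun j => ?_) j <;>
      simp [-Fin.succ_zero_eq_one, -Fin.succ_zero_eq_one', eM, SIdx.val, isNeg, Fin.ext_iff, Matrix.one_apply]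

lemma eM_neg (m : ℕ) (X : S) :
    eM (m + 2) (neg (m + 1)) X = bord 0 (Pi.single 0 1) (Pi.single 0 1) (bord X 0 0 1) := by
  apply bord_ext
  · simp [eM, SIdx.val, isNeg]
  · intro j; refine Fin.cases ?_ (fun j => ?_) j <;> simp [-Fin.succ_zero_eq_one, -Fin.succ_zero_eq_one', eM, SIdx.val, isNeg, Fin.ext_iff]
  · intro j; refine Fin.cases ?_ (fun j => ?_) j <;> simp [-Fin.succ_zero_eq_one, -Fin.succ_zero_eq_one', eM, SIdx.val, isNeg, Fin.ext_iff]
  · intro i j; refine Fin.cases ?_ (fun i => ?_) i <;> refine Fin.cases ?_ (fun j => ?_) j <;>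
      simp [-Fin.succ_zero_eq_one, -Fin.succ_zero_eq_one', eM, SIdx.val, isNeg, Fin.ext_iff, Matrix.one_apply]

lemma eM_inv (m i : ℕ) (X : S) (h0 : 1 ≤ i) (h1 : i < m) :
    eM m (pos i) (-X) * eM m (neg i) X = 1 ∧ eM m (neg i) X * eM m (pos i) (-X) = 1 := by
  induction m with
  | zero => omega
  | succ m ih =>
    by_cases h : i < m
    · rw [eM_iota m (pos i) _ h, eM_iota m (neg i) _ h, ← iota_mul, ← iota_mul, (ih h).1, (ih h).2]
      exact ⟨iota_one, iota_one⟩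
    · obtain ⟨m, rfl⟩ : ∃ j, m = j + 1 := ⟨m - 1, by omega⟩
      obtain rfl : i = m + 1 := by omega
      rw [eM_pos, eM_neg]
      rw [← bord_bord_one]
      constructor <;>
      · apply bord_ext
        · simp [bord_mul]
        · intro j; refine Fin.cases ?_ (fun j => ?_) j <;>
            simp [-Fin.succ_zero_eq_one, -Fin.succ_zero_eq_one', bord_mul, Matrix.vecMul, dotProduct, Fin.sum_univ_succ]
        · intro j; refine Fin.cases ?_ (fun j => ?_) j <;>
            simp [-Fin.succ_zero_eq_one, -Fin.succ_zero_eq_one', bord_mul, Matrix.mulVec, dotProduct, Fin.sum_univ_succ]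
        · intro i j; refine Fin.cases ?_ (fun i => ?_) i <;> refine Fin.cases ?_ (fun j => ?_) j <;>
            simp [-Fin.succ_zero_eq_one, -Fin.succ_zero_eq_one', bord_mul, Matrix.vecMulVec_apply, dotProduct]

lemma eM_diag_mul (m : ℕ) (i j : SIdx) (hij : i.val = j.val) (hi : i.val = 0 ∨ i.val = m) (X Y : S)
    (h : X * Y = 1) : eM m i X * eM m j Y = 1 := by
  have e : ∀ (i : SIdx) (hi : i.val = 0 ∨ i.val = m) (X : S), eM m i X =
      Matrix.diagonal (fun p : Fin m => if (i.val = 0 ∧ (p : ℕ) = m - 1) ∨ (i.val ≠ 0 ∧ (p : ℕ) = 0)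
        then X else 1) := by
    intro i hi X
    ext p q
    simp only [eM, Matrix.diagonal_apply]
    grind
  rw [e i hi, e j (hij ▸ hi), Matrix.diagonal_mul_diagonal, hij]
  ext p q
  simp only [Matrix.diagonal_apply, Matrix.one_apply]
  split_ifs <;> simp [h]

lemma comm_top (X : S) (W : Matrix (Fin k) (Fin k) S) : Commute (bord X 0 0 1) (iota W) := by
  unfold Commute SemiconjBy iota
  apply bord_ext <;> intros <;> simp [-Fin.succ_zero_eq_one, -Fin.succ_zero_eq_one', bord_mul, Matrix.vecMulVec_apply]

lemma comm_pos (m : ℕ) (X : S) (W : Matrix (Fin m) (Fin m) S) :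
    Commute (eM (m + 2) (pos (m + 1)) X) (iota (iota W)) := by
  unfold Commute SemiconjBy iota
  rw [eM_pos]
  apply bord_ext
  · simp [bord_mul]
  · intro j; refine Fin.cases ?_ (fun j => ?_) j <;>
      simp [-Fin.succ_zero_eq_one, -Fin.succ_zero_eq_one', bord_mul, Matrix.vecMul, dotProduct, Fin.sum_univ_succ]
  · intro j; refine Fin.cases ?_ (fun j => ?_) j <;>
      simp [-Fin.succ_zero_eq_one, -Fin.succ_zero_eq_one', bord_mul, Matrix.mulVec, dotProduct, Fin.sum_univ_succ]
  · intro i j; refine Fin.cases ?_ (fun i => ?_) i <;> refine Fin.cases ?_ (fun j => ?_) j <;>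
      simp [-Fin.succ_zero_eq_one, -Fin.succ_zero_eq_one', bord_mul, Matrix.vecMulVec_apply, dotProduct]

lemma lbd_iota (Q : S) : lbd (k + 2) Q = iota (lbd (k + 1) Q) := by
  apply bord_ext <;> intros <;> simp only [iota, bord_zz, bord_zs, bord_sz, bord_ss, lbd,
    Fin.ext_iff, Fin.val_zero, Fin.val_succ, Pi.zero_apply] <;> grind

end bordlemmas

/-- equivalence by units -/
def Eqv {T : Type*} [Monoid T] (A B : T) : Prop := ∃ U V : T, IsUnit U ∧ IsUnit V ∧ U * A * V = B

lemma Eqv.trans {T : Type*} [Monoid T] {A B C : T} (h : Eqv A B) (h' : Eqv B C) : Eqv A C := by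
  obtain ⟨U, V, hU, hV, rfl⟩ := h
  obtain ⟨U', V', hU', hV', rfl⟩ := h'
  exact ⟨U' * U, V * V', hU'.mul hU, hV.mul hV', by simp only [mul_assoc]⟩

lemma Eqv.symm {T : Type*} [Monoid T] {A B : T} (h : Eqv A B) : Eqv B A := by
  obtain ⟨U, V, ⟨u, rfl⟩, ⟨v, rfl⟩, rfl⟩ := h
  exact ⟨↑u⁻¹, ↑v⁻¹, u⁻¹.isUnit, v⁻¹.isUnit, by simp [mul_assoc]⟩

lemma Eqv.refl {T : Type*} [Monoid T] (A : T) : Eqv A A :=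
  ⟨1, 1, isUnit_one, isUnit_one, by simp⟩

lemma iota_isUnit {S : Type*} [Ring S] {k : ℕ} {U : Matrix (Fin k) (Fin k) S} (h : IsUnit U) :
    IsUnit (iota U) := by
  obtain ⟨u, rfl⟩ := h
  refine ⟨⟨iota u, iota ↑u⁻¹, ?_, ?_⟩, rfl⟩ <;> rw [← iota_mul] <;> simp [iota_one]

lemma Eqv.iota {S : Type*} [Ring S] {k : ℕ} {A B : Matrix (Fin k) (Fin k) S} (h : Eqv A B) :
    Eqv (iota A) (iota B) := by
  obtain ⟨U, V, hU, hV, rfl⟩ := h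
  exact ⟨_, _, iota_isUnit hU, iota_isUnit hV, by simp [iota_mul]⟩

lemma isUnit_of {T : Type*} [Monoid T] {a b : T} (h : a * b = 1) (h' : b * a = 1) : IsUnit a :=
  ⟨⟨a, b, h, h'⟩, rfl⟩

/-- lower bordered is a unit -/
lemma isUnit_low {S : Type*} [Ring S] {k : ℕ} (e : S) (he : e * e = 1) (c : Fin k → S) :
    IsUnit (bord e 0 c (1 : Matrix (Fin k) (Fin k) S)) := by
  refine isUnit_of (b := bord e 0 (fun i => - (c i * e)) 1) ?_ ?_ <;>
  rw [← bord_one, bord_mul] <;> apply bord_ext <;> intros <;> simp [Matrix.vecMulVec_apply, he, mul_assoc]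

lemma isUnit_up {S : Type*} [Ring S] {k : ℕ} (e : S) (he : e * e = 1) (r : Fin k → S) :
    IsUnit (bord e r 0 (1 : Matrix (Fin k) (Fin k) S)) := by
  refine isUnit_of (b := bord e (fun i => - (e * r i)) 0 1) ?_ ?_ <;>
  rw [← bord_one, bord_mul] <;> apply bord_ext <;> intros <;>
    simp [Matrix.vecMulVec_apply, he, ← mul_assoc]

lemma peel_left {R S : Type*} [CommRing R] [Ring S] [Algebra R S] (t : R) (k : ℕ) (B C : S)
    (W : Matrix (Fin (k + 1)) (Fin (k + 1)) S) :
    bord (-1) 0 (Pi.single 0 (t • C)) 1 * iota (t • bord (B + t • C) 0 0 1 - W) * bord 1 (Pi.single 0 (algebraMap R S (-t))) 0 1 =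
    t • (bord 0 (Pi.single 0 1) (Pi.single 0 1) (bord B 0 0 1) * bord C 0 0 1) - iota W := by
  unfold iota
  apply bord_ext
  · simp [bord_mul]
  · intro j; refine Fin.cases ?_ (fun j => ?_) j <;>
      simp [-Fin.succ_zero_eq_one, -Fin.succ_zero_eq_one', bord_mul, Matrix.vecMul, dotProduct,
        Fin.sum_univ_succ, Matrix.one_apply_ne (Fin.succ_ne_zero _).symm, Algebra.algebraMap_eq_smul_one]
  · intro j; refine Fin.cases ?_ (fun j => ?_) j <;>
      simp [-Fin.succ_zero_eq_one, -Fin.succ_zero_eq_one', bord_mul, Matrix.mulVec, dotProduct,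
        Fin.sum_univ_succ, Matrix.one_apply_ne (Fin.succ_ne_zero _).symm, Algebra.algebraMap_eq_smul_one]
  · intro i j; refine Fin.cases ?_ (fun i => ?_) i <;> refine Fin.cases ?_ (fun j => ?_) j <;>
      simp [-Fin.succ_zero_eq_one, -Fin.succ_zero_eq_one', bord_mul, Matrix.vecMulVec_apply,
        Algebra.algebraMap_eq_smul_one]
    abel

lemma peel_right {R S : Type*} [CommRing R] [Ring S] [Algebra R S] (t : R) (k : ℕ) (B C : S)
    (W : Matrix (Fin (k + 1)) (Fin (k + 1)) S) :
    bord 1 0 (Pi.single 0 (algebraMap R S (-t))) 1 * iota (t • bord (B + t • C) 0 0 1 - W) * bord (-1) (Pi.single 0 (t • C)) 0 1 =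
    t • (bord C 0 0 1 * bord 0 (Pi.single 0 1) (Pi.single 0 1) (bord B 0 0 1)) - iota W := by
  unfold iota
  apply bord_ext
  · simp [bord_mul]
  · intro j; refine Fin.cases ?_ (fun j => ?_) j <;>
      simp [-Fin.succ_zero_eq_one, -Fin.succ_zero_eq_one', bord_mul, Matrix.vecMul, dotProduct,
        Fin.sum_univ_succ, Matrix.one_apply_ne (Fin.succ_ne_zero _).symm, Algebra.algebraMap_eq_smul_one]
  · intro j; refine Fin.cases ?_ (fun j => ?_) j <;>
      simp [-Fin.succ_zero_eq_one, -Fin.succ_zero_eq_one', bord_mul, Matrix.mulVec, dotProduct,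
        Fin.sum_univ_succ, Matrix.one_apply_ne (Fin.succ_ne_zero _).symm, Algebra.algebraMap_eq_smul_one]
  · intro i j; refine Fin.cases ?_ (fun i => ?_) i <;> refine Fin.cases ?_ (fun j => ?_) j <;>
      simp [-Fin.succ_zero_eq_one, -Fin.succ_zero_eq_one', bord_mul, Matrix.vecMulVec_apply,
        Algebra.algebraMap_eq_smul_one]
    abel

/-- moving an element to the front or the back -/
lemma prod_move {T ι : Type*} [Monoid T] (f : ι → T) (a b : List ι) (x : ι)
    (h : (∀ y ∈ a, Commute (f x) (f y)) ∨ (∀ y ∈ b, Commute (f x) (f y))) :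
    ((a ++ x :: b).map f).prod = f x * ((a ++ b).map f).prod ∨
    ((a ++ x :: b).map f).prod = ((a ++ b).map f).prod * f x := by
  rcases h with h | h
  · left
    have : Commute (f x) (a.map f).prod := Commute.list_prod_right _ _ (by simpa using h)
    simp only [List.map_append, List.prod_append, List.map_cons, List.prod_cons, ← mul_assoc]
    rw [this.eq]
  · right
    have : Commute (f x) (b.map f).prod := Commute.list_prod_right _ _ (by simpa using h)
    simp only [List.map_append, List.prod_append, List.map_cons, List.prod_cons, mul_assoc]
    rw [this.eq]

lemma prod_inv {T ι : Type*} [Monoid T] (f g : ι → T) (l : List ι)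
    (h : ∀ x ∈ l, f x * g x = 1) : (l.map f).prod * (l.reverse.map g).prod = 1 := by
  induction l with
  | nil => simp
  | cons x l ih =>
    have := ih (fun y hy => h y (by simp [hy]))
    simp only [List.map_cons, List.prod_cons, List.reverse_cons, List.map_append, List.prod_append,
      List.map_nil, List.prod_nil, mul_one]
    calc _ = f x * ((l.map f).prod * (l.reverse.map g).prod) * g x := by simp only [mul_assoc]
      _ = 1 := by rw [this, mul_one, h x (by simp)]

lemma prod_inv' {T ι : Type*} [Monoid T] (f g : ι → T) (l : List ι)
    (h : ∀ x ∈ l, g x * f x = 1) : (l.reverse.map g).prod * (l.map f).prod = 1 := by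
  simpa using prod_inv g f l.reverse (by simpa using h)

lemma core {R S : Type*} [CommRing R] [Ring S] [Algebra R S] (t : R) (k : ℕ) :
    ∀ (A : ℕ → S) (l : List ℕ), l.Perm (List.range (k + 1)) →
    Eqv (t • eM (k + 1) (neg (k + 1)) (A (k + 1)) -
        (l.map (fun i => eM (k + 1) (pos i) (-A i))).prod)
      (lbd (k + 1) (∑ i ∈ Finset.range (k + 2), t ^ i • A i)) := by
  induction k with
  | zero =>
    intro A l hl
    obtain rfl : l = [0] := by simpa using hl
    convert Eqv.refl _
    ext p q
    have hp := Fin.fin_one_eq_zero p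
    have hq := Fin.fin_one_eq_zero q
    subst hp hq
    simp [eM, lbd, SIdx.val, Finset.sum_range_succ]
    abel
  | succ k ih =>
    intro A l hl
    set A' : ℕ → S := fun i => if i = k + 1 then A (k + 1) + t • A (k + 2) else A i with hA'
    have hsum : ∑ i ∈ Finset.range (k + 1 + 2), t ^ i • A i =
        ∑ i ∈ Finset.range (k + 2), t ^ i • A' i := by
      rw [Finset.sum_range_succ, Finset.sum_range_succ, Finset.sum_range_succ _ (k + 1)]
      have : ∑ i ∈ Finset.range (k + 1), t ^ i • A' i = ∑ i ∈ Finset.range (k + 1), t ^ i • A i := by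
        refine Finset.sum_congr rfl fun i hi => ?_
        have : i ≠ k + 1 := by have := Finset.mem_range.1 hi; omega
        simp [hA', this]
      rw [this]
      simp only [hA', if_true, smul_add, smul_smul, pow_succ]
      abel
    have hmem : k + 1 ∈ l := hl.mem_iff.2 (by simp)
    obtain ⟨a, b, rfl⟩ := List.append_of_mem hmem
    have hnd : (a ++ (k + 1) :: b).Nodup := hl.nodup_iff.2 List.nodup_range
    have hp : (a ++ b).Perm (List.range (k + 1)) := by
      rw [List.perm_iff_count] at hl ⊢
      intro c
      have := hl c
      rw [List.range_succ] at this
      simp only [List.count_append, List.count_cons, List.count_nil] at this ⊢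
      omega
    have hlt : ∀ y ∈ a ++ b, y < k + 1 := fun y hy => by simpa using hp.mem_iff.1 hy
    set W := ((a ++ b).map (fun i => eM (k + 1) (pos i) (-A i))).prod with hW
    have hrest : ((a ++ b).map (fun i => eM (k + 1 + 1) (pos i) (-A i))).prod = iota W := by
      rw [hW, ← iota_prod, List.map_map]
      congr 1
      refine List.map_congr_left fun y hy => ?_
      exact eM_iota _ _ _ (hlt y hy)
    have hW' : W = ((a ++ b).map (fun i => eM (k + 1) (pos i) (-A' i))).prod := by
      rw [hW]
      congr 1
      refine List.map_congr_left fun y hy => ?_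
      have : y ≠ k + 1 := by have := hlt y hy; omega
      simp [hA', this]
    have hfin := (ih A' (a ++ b) hp).iota
    rw [← lbd_iota, ← hsum, ← hW'] at hfin
    refine Eqv.trans ?_ hfin
    have hcom : ∀ y, y < k → Commute (eM (k + 1 + 1) (pos (k + 1)) (-A (k + 1)))
        (eM (k + 1 + 1) (pos y) (-A y)) := by
      intro y hy
      rw [eM_iota (k + 1) (pos y) _ (by simp [SIdx.val]; omega), eM_iota k (pos y) _ (by simpa [SIdx.val])]
      exact comm_pos _ _ _
    have hside : (∀ y ∈ a, Commute (eM (k + 1 + 1) (pos (k + 1)) (-A (k + 1)))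
        (eM (k + 1 + 1) (pos y) (-A y))) ∨ (∀ y ∈ b, Commute (eM (k + 1 + 1) (pos (k + 1)) (-A (k + 1)))
        (eM (k + 1 + 1) (pos y) (-A y))) := by
      have hnd' : (a ++ b).Nodup := hp.nodup_iff.2 List.nodup_range
      by_cases hk : k ∈ a
      · right
        intro y hy
        have h1 := hlt y (by simp [hy])
        have : y ≠ k := by
          rintro rfl
          exact (List.disjoint_of_nodup_append hnd') hk hy
        exact hcom y (by omega)
      · left
        intro y hy
        have h1 := hlt y (by simp [hy])
        have : y ≠ k := by
          rintro rfl
          exact hk hy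
        exact hcom y (by omega)
    have hinv := eM_inv (k + 2) (k + 1) (A (k + 1)) (by omega) (by omega)
    have hG : IsUnit (eM (k + 2) (neg (k + 1)) (A (k + 1))) := isUnit_of hinv.2 hinv.1
    have hD' : A' (k + 1) = A (k + 1) + t • A (k + 2) := by simp [hA']
    rw [hD']
    rcases prod_move (fun i => eM (k + 1 + 1) (pos i) (-A i)) a b (k + 1) hside with h | h
    · rw [h, hrest]
      refine Eqv.trans (B := t • (eM (k + 2) (neg (k + 1)) (A (k + 1)) *
        eM (k + 2) (neg (k + 2)) (A (k + 2))) - iota W) ⟨_, 1, hG, isUnit_one, ?_⟩ ?_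
      · rw [mul_one, mul_sub, mul_smul_comm, ← mul_assoc _ _ (iota W), hinv.2, one_mul]
      · refine Eqv.symm ⟨bord (-1) 0 (Pi.single 0 (t • A (k + 2))) 1,
          bord 1 (Pi.single 0 (algebraMap R S (-t))) 0 1, isUnit_low _ (by simp) _,
          isUnit_up _ (by simp) _, ?_⟩
        rw [eM_neg, eM_top (k + 1) (neg (k + 2)) _ rfl, eM_top k (neg (k + 1)) _ rfl]
        exact peel_left t k _ _ W
    · rw [h, hrest]
      refine Eqv.trans (B := t • (eM (k + 2) (neg (k + 2)) (A (k + 2)) *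
        eM (k + 2) (neg (k + 1)) (A (k + 1))) - iota W) ⟨1, _, isUnit_one, hG, ?_⟩ ?_
      · rw [one_mul, sub_mul, smul_mul_assoc, mul_assoc (iota W), hinv.1, mul_one]
      · refine Eqv.symm ⟨bord 1 0 (Pi.single 0 (algebraMap R S (-t))) 1,
          bord (-1) (Pi.single 0 (t • A (k + 2))) 0 1, isUnit_low _ (by simp) _,
          isUnit_up _ (by simp) _, ?_⟩
        rw [eM_neg, eM_top (k + 1) (neg (k + 2)) _ rfl, eM_top k (neg (k + 1)) _ rfl]
        exact peel_right t k _ _ W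

lemma gfp {R S : Type*} [CommRing R] [Ring S] [Algebra R S] (t : R) (k : ℕ) (A : ℕ → S)
    (F : SIdx → S) (sig tau : List ℕ) (hperm : (sig ++ tau).Perm (List.range (k + 2)))
    (hFp : ∀ i ≤ k, F (pos i) = -A i) (hFn : ∀ i, 1 ≤ i → i ≤ k + 1 → F (neg i) = A i)
    (h0 : 0 ∈ tau → F (neg 0) * (-A 0) = 1 ∧ (-A 0) * F (neg 0) = 1)
    (hm : k + 1 ∈ sig → F (pos (k + 1)) * A (k + 1) = 1 ∧ A (k + 1) * F (pos (k + 1)) = 1) :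
    Eqv (t • (tau.map (fun i => eM (k + 1) (neg i) (F (neg i)))).prod -
        (sig.map (fun i => eM (k + 1) (pos i) (F (pos i)))).prod)
      (lbd (k + 1) (∑ i ∈ Finset.range (k + 2), t ^ i • A i)) := by
  set Mp : ℕ → Matrix (Fin (k + 1)) (Fin (k + 1)) S := fun i => eM (k + 1) (pos i) (F (pos i)) with hMp
  set Mn : ℕ → Matrix (Fin (k + 1)) (Fin (k + 1)) S := fun i => eM (k + 1) (neg i) (F (neg i)) with hMn
  have hinv : ∀ i, (1 ≤ i ∧ i ≤ k) ∨ (i = 0 ∧ 0 ∈ tau) ∨ (i = k + 1 ∧ k + 1 ∈ sig) →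
      Mp i * Mn i = 1 ∧ Mn i * Mp i = 1 := by
    rintro i (⟨h1, h2⟩ | ⟨rfl, h⟩ | ⟨rfl, h⟩)
    · simp only [hMp, hMn, hFp i h2, hFn i h1 (by omega)]
      exact eM_inv _ _ _ h1 (by omega)
    · simp only [hMp, hMn, hFp 0 (by omega)]
      exact ⟨eM_diag_mul _ _ _ rfl (Or.inl rfl) _ _ (h0 h).2,
        eM_diag_mul _ _ _ rfl (Or.inl rfl) _ _ (h0 h).1⟩
    · simp only [hMp, hMn, hFn (k + 1) (by omega) le_rfl]
      exact ⟨eM_diag_mul (k + 1) (pos (k + 1)) (SIdx.neg (k + 1)) rfl (Or.inr rfl) _ _ (hm h).1,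
        eM_diag_mul (k + 1) (SIdx.neg (k + 1)) (pos (k + 1)) rfl (Or.inr rfl) _ _ (hm h).2⟩
  have hmem : ∀ i, i ∈ sig ∨ i ∈ tau ↔ i < k + 2 := fun i => by
    simpa using hperm.mem_iff (a := i)
  have hnd : (sig ++ tau).Nodup := hperm.nodup_iff.2 List.nodup_range
  have hcore : ∀ l : List ℕ, l.Perm (List.range (k + 1)) →
      Eqv (t • Mn (k + 1) - (l.map Mp).prod)
        (lbd (k + 1) (∑ i ∈ Finset.range (k + 2), t ^ i • A i)) := by
    intro l hl
    have h1 : l.map Mp = l.map (fun i => eM (k + 1) (pos i) (-A i)) := by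
      refine List.map_congr_left fun y hy => ?_
      have : y < k + 1 := by simpa using hl.mem_iff.1 hy
      simp only [hMp, hFp y (by omega)]
    rw [h1]
    simp only [hMn, hFn (k + 1) (by omega) le_rfl]
    exact core t k A l hl
  rcases (hmem (k + 1)).2 (by omega) with hs | ht
  · -- leading index in `sig`
    obtain ⟨a, b, rfl⟩ := List.append_of_mem hs
    have hp : ∀ c, List.count c (a ++ b ++ tau) = List.count c (List.range (k + 1)) := by
      intro c
      have := (List.perm_iff_count.1 hperm) c
      rw [List.range_succ] at this
      simp only [List.count_append, List.count_cons, List.count_nil] at this ⊢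
      omega
    have hp1 : (a ++ b ++ tau).Perm (List.range (k + 1)) := List.perm_iff_count.2 hp
    have hlt : ∀ y ∈ a ++ b ++ tau, y < k + 1 := fun y hy => by simpa using hp1.mem_iff.1 hy
    have hnd' : (a ++ b ++ tau).Nodup := hp1.nodup_iff.2 List.nodup_range
    have htau : ∀ y ∈ tau, Mp y * Mn y = 1 ∧ Mn y * Mp y = 1 := by
      intro y hy
      have := hlt y (by simp [hy])
      refine hinv y ?_
      rcases Nat.eq_zero_or_pos y with rfl | h
      · exact Or.inr (Or.inl ⟨rfl, hy⟩)
      · exact Or.inl ⟨h, by omega⟩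
    have hT1 := prod_inv Mn Mp tau (fun x hx => (htau x hx).2)
    have hT2 := prod_inv' Mn Mp tau (fun x hx => (htau x hx).1)
    have hM := hinv (k + 1) (Or.inr (Or.inr ⟨rfl, hs⟩))
    have hcom : ∀ y, y < k → Commute (Mp (k + 1)) (Mp y) := by
      intro y hy
      simp only [hMp]
      rw [eM_top k (pos (k + 1)) _ rfl, eM_iota k (pos y) _ (by simpa [SIdx.val])]
      exact comm_top _ _
    have hside : (∀ y ∈ a, Commute (Mp (k + 1)) (Mp y)) ∨
        (∀ y ∈ b, Commute (Mp (k + 1)) (Mp y)) := by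
      by_cases hk : k ∈ a
      · right
        intro y hy
        have h1 := hlt y (by simp [hy])
        have : y ≠ k := by
          rintro rfl
          exact (List.disjoint_of_nodup_append (hnd'.of_append_left)) hk hy
        exact hcom y (by omega)
      · left
        intro y hy
        have h1 := hlt y (by simp [hy])
        have : y ≠ k := by
          rintro rfl
          exact hk hy
        exact hcom y (by omega)
    rcases prod_move Mp a b (k + 1) hside with h | h
    · rw [h]
      refine Eqv.trans ?_ (hcore (a ++ b ++ tau.reverse) (List.perm_iff_count.2 fun c => ?_))
      · refine ⟨Mn (k + 1), (tau.reverse.map Mp).prod, isUnit_of hM.2 hM.1, isUnit_of hT2 hT1, ?_⟩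
        rw [mul_sub, sub_mul, mul_smul_comm, smul_mul_assoc, mul_assoc, hT1, mul_one, ← mul_assoc,
          hM.2, one_mul, List.map_append (l₁ := a ++ b), List.prod_append]
      · rw [← hp c]; simp
    · rw [h]
      refine Eqv.trans ?_ (hcore (tau.reverse ++ (a ++ b)) (List.perm_iff_count.2 fun c => ?_))
      · refine ⟨(tau.reverse.map Mp).prod, Mn (k + 1), isUnit_of hT2 hT1, isUnit_of hM.2 hM.1, ?_⟩
        rw [mul_sub, sub_mul, mul_smul_comm, smul_mul_assoc, hT2, one_mul, ← mul_assoc, mul_assoc _ (Mp _),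
          hM.1, mul_one, List.map_append (l₂ := a ++ b), List.prod_append]
      · rw [← hp c]; simp only [List.count_append, List.count_reverse]; omega
  · -- leading index in `tau`
    obtain ⟨a, b, rfl⟩ := List.append_of_mem ht
    have hp : ∀ c, List.count c (a ++ sig ++ b) = List.count c (List.range (k + 1)) := by
      intro c
      have := (List.perm_iff_count.1 hperm) c
      rw [List.range_succ] at this
      simp only [List.count_append, List.count_cons, List.count_nil] at this ⊢
      omega
    have hp1 : (a ++ sig ++ b).Perm (List.range (k + 1)) := List.perm_iff_count.2 hp
    have hlt : ∀ y ∈ a ++ sig ++ b, y < k + 1 := fun y hy => by simpa using hp1.mem_iff.1 hy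
    have htau : ∀ y, y ∈ a ∨ y ∈ b → Mp y * Mn y = 1 ∧ Mn y * Mp y = 1 := by
      intro y hy
      have := hlt y (by rcases hy with hy | hy <;> simp [hy])
      refine hinv y ?_
      rcases Nat.eq_zero_or_pos y with rfl | h
      · exact Or.inr (Or.inl ⟨rfl, by rcases hy with hy | hy <;> simp [hy]⟩)
      · exact Or.inl ⟨h, by omega⟩
    have ha1 := prod_inv Mn Mp a (fun x hx => (htau x (Or.inl hx)).2)
    have ha2 := prod_inv' Mn Mp a (fun x hx => (htau x (Or.inl hx)).1)
    have hb1 := prod_inv Mn Mp b (fun x hx => (htau x (Or.inr hx)).2)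
    have hb2 := prod_inv' Mn Mp b (fun x hx => (htau x (Or.inr hx)).1)
    refine Eqv.trans ?_ (hcore (a.reverse ++ sig ++ b.reverse) (List.perm_iff_count.2 fun c => ?_))
    · refine ⟨(a.reverse.map Mp).prod, (b.reverse.map Mp).prod, isUnit_of ha2 ha1,
        isUnit_of hb2 hb1, ?_⟩
      rw [mul_sub, sub_mul, mul_smul_comm, smul_mul_assoc, List.map_append (l₁ := a), List.prod_append,
        ← mul_assoc, ha2, one_mul, List.map_cons, List.prod_cons, mul_assoc, hb1, mul_one,
        List.map_append, List.map_append, List.prod_append, List.prod_append]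
    · rw [← hp c]; simp

/-- the index map induced by block reversal -/
def flip (m : ℕ) : SIdx → SIdx
  | SIdx.pos i => SIdx.neg (m - i)
  | SIdx.neg i => SIdx.pos (m - i)

lemma eM_flip {S : Type*} [Ring S] (m : ℕ) (i : SIdx) (hm : 1 ≤ m) (hi : i.val ≤ m) (X : S) :
    (eM m i X).submatrix Fin.rev Fin.rev = eM m (flip m i) X := by
  have hv : (flip m i).val = m - i.val := by cases i <;> rfl
  have hs : (flip m i).isNeg = !i.isNeg := by cases i <;> rfl
  ext p q
  have h1 := p.2
  have h2 := q.2
  simp only [Matrix.submatrix_apply, eM, hv, hs, Fin.rev_inj, Fin.val_rev, Fin.ext_iff]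
  generalize i.val = v at *
  generalize i.isNeg = s at *
  obtain ⟨d, rfl⟩ : ∃ d, m = v + d := ⟨m - v, by omega⟩
  rcases Nat.eq_zero_or_pos v with rfl | hv
  · cases s <;> grind
  · rcases Nat.eq_zero_or_pos d with rfl | hd
    · cases s <;> grind
    · have e1 : v ≠ 0 := by omega
      have e2 : v ≠ v + d := by omega
      have e3 : v + d - v = d := by omega
      have e4 : d ≠ 0 := by omega
      have e5 : d ≠ v + d := by omega
      have e6 : v + d - d = v := by omega
      have e7 : v + d - (p + 1) = d - 1 ↔ p = v := by omega
      have e8 : v + d - (q + 1) = d - 1 ↔ q = v := by omega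
      have e9 : v + d - (p + 1) = d ↔ p = v - 1 := by omega
      have e10 : v + d - (q + 1) = d ↔ q = v - 1 := by omega
      have e11 : v + d - (p + 1) = v + d - (q + 1) ↔ p = q := by omega
      simp only [e1, e2, e3, e4, e5, e6, e7, e8, e9, e10, if_false]
      cases s <;> grind

/-- the block reversal matrix -/
def rv (S : Type*) [Ring S] (m : ℕ) : Matrix (Fin m) (Fin m) S := fun i j =>
  if Fin.rev i = j then 1 else 0

lemma rv_mul_mul {S : Type*} [Ring S] {m : ℕ} (M : Matrix (Fin m) (Fin m) S) :
    rv S m * M * rv S m = M.submatrix Fin.rev Fin.rev := by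
  ext i j
  have : ∀ x : Fin m, x.rev = j ↔ x = j.rev := fun x => by
    constructor
    · rintro rfl; simp
    · rintro rfl; simp
  simp [Matrix.mul_apply, rv, this]

lemma rv_mul_rv {S : Type*} [Ring S] {m : ℕ} : rv S m * rv S m = 1 := by
  have := rv_mul_mul (1 : Matrix (Fin m) (Fin m) S)
  rw [mul_one] at this
  rw [this]
  ext i j
  simp [Matrix.one_apply]

lemma lbd_mul_neg {S : Type*} [Ring S] (m : ℕ) (Q Q' : S) :
    lbd m Q * lbd m Q' = lbd m (Q * Q') := by
  have h : ∀ Q : S, lbd m Q = Matrix.diagonal (fun i : Fin m => if (i : ℕ) = m - 1 then Q else 1) := by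
    intro Q
    ext i j
    have := i.2
    have := j.2
    simp only [lbd, Matrix.diagonal_apply, Fin.ext_iff]
    split_ifs <;> first | rfl | omega
  rw [h, h, h, Matrix.diagonal_mul_diagonal]
  congr 1
  ext i
  split_ifs <;> simp

lemma lbd_one {S : Type*} [Ring S] (m : ℕ) : lbd m (1 : S) = 1 := by
  ext i j
  simp only [lbd, Matrix.one_apply, Fin.ext_iff]
  split_ifs <;> first | rfl | omega

lemma rv_prod {S : Type*} [Ring S] {m : ℕ} (l : List (Matrix (Fin m) (Fin m) S)) :
    rv S m * l.prod * rv S m = (l.map (fun M => M.submatrix Fin.rev Fin.rev)).prod := by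
  induction l with
  | nil => simp [rv_mul_rv]
  | cons a l ih =>
    rw [List.prod_cons, List.map_cons, List.prod_cons, ← ih, ← rv_mul_mul]
    have : rv S m * a * rv S m * (rv S m * l.prod * rv S m) =
      rv S m * a * (rv S m * rv S m) * l.prod * rv S m := by noncomm_ring
    rw [this, rv_mul_rv]
    noncomm_ring

lemma gfp_rev {R S : Type*} [CommRing R] [Ring S] [Algebra R S] (t : R) (k : ℕ) (A : ℕ → S)
    (F : SIdx → S) (sig tau : List ℕ) (hperm : (sig ++ tau).Perm (List.range (k + 2)))
    (hFp : ∀ i ≤ k, F (pos i) = -A i) (hFn : ∀ i, 1 ≤ i → i ≤ k + 1 → F (SIdx.neg i) = A i)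
    (h0 : 0 ∈ tau → F (SIdx.neg 0) * (-A 0) = 1 ∧ (-A 0) * F (SIdx.neg 0) = 1)
    (hm : k + 1 ∈ sig → F (pos (k + 1)) * A (k + 1) = 1 ∧ A (k + 1) * F (pos (k + 1)) = 1) :
    Eqv ((tau.map (fun i => eM (k + 1) (SIdx.neg i) (F (SIdx.neg i)))).prod -
        t • (sig.map (fun i => eM (k + 1) (pos i) (F (pos i)))).prod)
      (lbd (k + 1) (∑ i ∈ Finset.range (k + 2), t ^ (k + 1 - i) • A i)) := by
  have hle : ∀ i, i ∈ sig ∨ i ∈ tau → i ≤ k + 1 := fun i hi => by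
    have : i ∈ List.range (k + 2) := hperm.mem_iff.1 (by simpa using hi)
    have := List.mem_range.1 this
    omega
  have hperm' : ((tau.map (fun i => k + 1 - i)) ++ (sig.map (fun i => k + 1 - i))).Perm
      (List.range (k + 2)) := by
    have h1 : ((sig ++ tau).map (fun i => k + 1 - i)).Perm
        ((List.range (k + 2)).map (fun i => k + 1 - i)) := hperm.map _
    have h2 : (List.range (k + 2)).map (fun i => k + 1 - i) = (List.range (k + 2)).reverse := by
      apply List.ext_getElem
      · simp
      · intro i h1 h2
        simp
    rw [h2, List.map_append] at h1
    exact (List.perm_append_comm.trans h1).trans (List.reverse_perm _)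
  have hsub : ∀ i, i ≤ k + 1 → k + 1 - (k + 1 - i) = i := fun i hi => by omega
  have key := gfp t k (fun j => -A (k + 1 - j)) (fun i => F (flip (k + 1) i)) _ _ hperm'
    (by
      intro i hi
      simp only [flip, neg_neg]
      exact hFn _ (by omega) (by omega))
    (by
      intro i h1 h2
      simp only [flip]
      exact hFp _ (by omega))
    (by
      intro h
      obtain ⟨y, hy, hy'⟩ := List.mem_map.1 h
      have := hle y (Or.inl hy)
      obtain rfl : y = k + 1 := by omega
      simpa [flip] using hm hy)
    (by
      intro h
      obtain ⟨y, hy, hy'⟩ := List.mem_map.1 h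
      have := hle y (Or.inr hy)
      obtain rfl : y = 0 := by omega
      simpa [flip] using h0 hy)
  have hT : ((tau.map (fun i => k + 1 - i)).map
      (fun i => eM (k + 1) (pos i) (F (flip (k + 1) (pos i))))).prod =
      rv S (k + 1) * (tau.map (fun i => eM (k + 1) (SIdx.neg i) (F (SIdx.neg i)))).prod *
        rv S (k + 1) := by
    rw [rv_prod, List.map_map, List.map_map]
    congr 1
    refine List.map_congr_left fun i hi => ?_
    have := hle i (Or.inr hi)
    simp only [Function.comp]
    rw [eM_flip _ _ (by omega) (by simpa [SIdx.val])]
    simp only [flip, hsub i this]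
  have hS : ((sig.map (fun i => k + 1 - i)).map
      (fun i => eM (k + 1) (SIdx.neg i) (F (flip (k + 1) (SIdx.neg i))))).prod =
      rv S (k + 1) * (sig.map (fun i => eM (k + 1) (pos i) (F (pos i)))).prod *
        rv S (k + 1) := by
    rw [rv_prod, List.map_map, List.map_map]
    congr 1
    refine List.map_congr_left fun i hi => ?_
    have := hle i (Or.inl hi)
    simp only [Function.comp]
    rw [eM_flip _ _ (by omega) (by simpa [SIdx.val])]
    simp only [flip, hsub i this]
  rw [hT, hS] at key
  have hsum : ∑ i ∈ Finset.range (k + 2), t ^ i • (-A (k + 1 - i)) =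
      -∑ i ∈ Finset.range (k + 2), t ^ (k + 1 - i) • A i := by
    rw [← Finset.sum_range_reflect, ← Finset.sum_neg_distrib]
    refine Finset.sum_congr rfl fun i hi => ?_
    have := Finset.mem_range.1 hi
    rw [show k + 2 - 1 - i = k + 1 - i by omega, hsub i (by omega), smul_neg]
  rw [hsum] at key
  have hrv : IsUnit (rv S (k + 1)) := isUnit_of rv_mul_rv rv_mul_rv
  have hneg : IsUnit (-rv S (k + 1)) := hrv.neg
  have hl : lbd (k + 1) (-1 : S) * lbd (k + 1) (-1 : S) = 1 := by
    rw [lbd_mul_neg, neg_mul_neg, one_mul, lbd_one]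
  refine Eqv.trans ⟨-rv S (k + 1), rv S (k + 1), hneg, hrv, ?_⟩ (Eqv.trans key
    ⟨1, lbd (k + 1) (-1 : S), isUnit_one, isUnit_of hl hl, ?_⟩)
  · simp only [neg_mul, mul_sub, sub_mul, mul_smul_comm, smul_mul_assoc, smul_neg]
    abel
  · rw [one_mul, lbd_mul_neg, mul_neg, mul_one, neg_neg]

/-! Transfer to polynomial matrices -/

abbrev PM (n : ℕ) := Matrix (Fin n) (Fin n) (Polynomial ℂ)

/-- flattening of block matrices -/
noncomputable abbrev fl (m n : ℕ) :
    Matrix (Fin m) (Fin m) (PM n) ≃+* Matrix (Fin m × Fin n) (Fin m × Fin n) (Polynomial ℂ) :=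
  Matrix.compRingEquiv (Fin m) (Fin n) (Polynomial ℂ)

noncomputable abbrev cm (N : Type*) [Fintype N] [DecidableEq N] :
    Matrix N N ℂ →+* Matrix N N (Polynomial ℂ) := (Polynomial.C : ℂ →+* Polynomial ℂ).mapMatrix

lemma fl_apply {m n : ℕ} (M : Matrix (Fin m) (Fin m) (PM n)) (p q : Fin m × Fin n) :
    fl m n M p q = M p.1 q.1 p.2 q.2 := rfl

lemma cm_elem (m n : ℕ) (k : SIdx) (Z : Matrix (Fin n) (Fin n) ℂ) :
    cm _ (elemMat m n k Z) = fl m n (eM m k (cm _ Z)) := by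
  ext1 p q
  obtain ⟨p1, p2⟩ := p
  obtain ⟨q1, q2⟩ := q
  rw [fl_apply]
  simp only [RingHom.mapMatrix_apply, Matrix.map_apply, elemMat, eM, Prod.mk.injEq]
  split_ifs <;> simp_all [Matrix.one_apply]

lemma fl_lbd (m n : ℕ) (Q : PM n) : lastBlockDiag m n Q = fl m n (lbd m Q) := by
  ext1 p q
  obtain ⟨p1, p2⟩ := p
  obtain ⟨q1, q2⟩ := q
  rw [fl_apply]
  simp only [lastBlockDiag, lbd, Prod.mk.injEq]
  split_ifs <;> simp_all [Matrix.one_apply]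

lemma pencil_eq {N : Type*} [Fintype N] [DecidableEq N] (M1 M0 : Matrix N N ℂ) :
    pencilPoly M1 M0 = (Polynomial.X : Polynomial ℂ) • cm N M1 - cm N M0 := by
  ext1 p q
  exact congrArg₂ (· - ·) (mul_comm _ _) rfl

lemma revPencil_eq {N : Type*} [Fintype N] [DecidableEq N] (M1 M0 : Matrix N N ℂ) :
    revPencilPoly M1 M0 = cm N M1 - (Polynomial.X : Polynomial ℂ) • cm N M0 := by
  ext1 p q
  exact congrArg₂ (· - ·) rfl (mul_comm _ _)

lemma polyP_eq (m n : ℕ) (A : ℕ → Matrix (Fin n) (Fin n) ℂ) :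
    polyP m n A = ∑ i ∈ Finset.range (m + 1), (Polynomial.X : Polynomial ℂ) ^ i • cm _ (A i) := by
  ext1 p q
  rw [polyP, Matrix.sum_apply]
  exact Finset.sum_congr rfl fun i _ => mul_comm _ _

lemma revPolyP_eq (m n : ℕ) (A : ℕ → Matrix (Fin n) (Fin n) ℂ) :
    revPolyP m n A =
      ∑ i ∈ Finset.range (m + 1), (Polynomial.X : Polynomial ℂ) ^ (m - i) • cm _ (A i) := by
  ext1 p q
  rw [revPolyP, Matrix.sum_apply]
  exact Finset.sum_congr rfl fun i _ => mul_comm _ _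

lemma cm_prodFiedler (m n : ℕ) (A : ℕ → Matrix (Fin n) (Fin n) ℂ) (t : List SIdx) :
    cm _ (prodFiedler m n A t) =
      fl m n (t.map (fun k => eM m k (cm _ (fiedlerX m A k)))).prod := by
  rw [prodFiedler, map_list_prod, map_list_prod, List.map_map, List.map_map]
  congr 1
  exact List.map_congr_left fun k _ => cm_elem m n k _

lemma unit_inv {T : Type*} [Monoid T] {W : T} (h : IsUnit W) :
    ∃ W' : T, IsUnit W' ∧ W' * W = 1 ∧ W * W' = 1 := by
  obtain ⟨w, rfl⟩ := h
  exact ⟨_, w⁻¹.isUnit, w.inv_mul, w.mul_inv⟩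

lemma unit_elem (m n : ℕ) (hm : 1 ≤ m) (k : SIdx) (Z : Matrix (Fin n) (Fin n) ℂ) (hk : k.val ≤ m)
    (hZ : k.val = 0 ∨ k.val = m → IsUnit Z) : IsUnit (cm _ (elemMat m n k Z)) := by
  rw [cm_elem]
  refine IsUnit.map _ ?_
  by_cases h : k.val = 0 ∨ k.val = m
  · obtain ⟨Y, _, h1, h2⟩ := unit_inv ((hZ h).map (cm (Fin n)))
    exact isUnit_of (eM_diag_mul m k k rfl h _ Y h2) (eM_diag_mul m k k rfl h Y _ h1)
  · push Not at h
    cases k with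
    | pos i =>
      have := eM_inv m i (-(cm _ Z)) (by simp [SIdx.val] at h; omega) (by simp [SIdx.val] at h hk; omega)
      simp only [neg_neg] at this
      exact isUnit_of this.1 this.2
    | neg i =>
      have := eM_inv m i (cm _ Z) (by simp [SIdx.val] at h; omega) (by simp [SIdx.val] at h hk; omega)
      exact isUnit_of this.2 this.1

lemma unit_assign (m n : ℕ) (hm : 1 ≤ m) (t : List SIdx) (Xs : List (Matrix (Fin n) (Fin n) ℂ))
    (ht : ∀ k ∈ t, k.val ≤ m) (h : NonsingAssign m t Xs) : IsUnit (cm _ (prodAssign m n t Xs)) := by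
  rw [prodAssign, map_list_prod, List.map_map]
  have : ∀ l : List (SIdx × Matrix (Fin n) (Fin n) ℂ), (∀ p ∈ l, p ∈ t.zip Xs) →
      IsUnit (l.map ((cm (Fin m × Fin n)) ∘ fun p => elemMat m n p.1 p.2)).prod := by
    intro l
    induction l with
    | nil => intro _; simp
    | cons p l ih =>
      intro hl
      rw [List.map_cons, List.prod_cons]
      have hp := hl p (by simp)
      exact (unit_elem m n hm p.1 p.2 (ht _ (List.of_mem_zip hp).1) (h.2 p hp)).mul
        (ih fun q hq => hl q (by simp [hq]))
  exact this _ fun p hp => hp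

lemma lin_of {m n : ℕ} {L G W Z : Matrix (Fin m × Fin n) (Fin m × Fin n) (Polynomial ℂ)}
    {H : Matrix (Fin m) (Fin m) (PM n)} {Q : PM n} (hW : IsUnit W) (hZ : IsUnit Z)
    (hL : L = W * G * Z) (hG : G = fl m n H) (h : Eqv H (lbd m Q)) : IsLinearization L Q := by
  obtain ⟨U, V, hU, hV, hUV⟩ := h
  obtain ⟨W', hW', w1, w2⟩ := unit_inv hW
  obtain ⟨Z', hZ', z1, z2⟩ := unit_inv hZ
  refine ⟨fl m n U * W', Z' * fl m n V, ?_, ?_, ?_⟩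
  · exact (Matrix.isUnit_iff_isUnit_det _).1 ((hU.map (fl m n)).mul hW')
  · exact (Matrix.isUnit_iff_isUnit_det _).1 (hZ'.mul (hV.map (fl m n)))
  · rw [fl_lbd, ← hUV, map_mul, map_mul, hL, ← hG]
    calc _ = fl m n U * (W' * W) * G * (Z * Z') * fl m n V := by simp only [mul_assoc]
      _ = _ := by rw [w1, z2, mul_one, mul_one]

theorem main_aux {m n : ℕ} (E : EGFPData m n) :
    IsLinearization (pencilPoly E.L1 E.L0) (polyP m n E.A) ∧
    IsLinearization (revPencilPoly E.L1 E.L0) (revPolyP m n E.A) := by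
  obtain ⟨k, rfl⟩ : ∃ k, m = k + 1 := ⟨m - 1, by have := E.hm; omega⟩
  have hle : ∀ x, x ∈ E.sig ∨ x ∈ E.tau → x.val ≤ k + 1 := fun x hx => by
    have : x.val ∈ List.range (k + 1 + 1) := E.hperm.mem_iff.1 (by
      rcases hx with hx | hx
      · exact List.mem_append_left _ (List.mem_map_of_mem hx)
      · exact List.mem_append_right _ (List.mem_map_of_mem hx))
    have := List.mem_range.1 this
    omega
  have hW : IsUnit (cm _ E.leftFac) := by
    rw [EGFPData.leftFac, map_mul]
    exact (unit_assign _ _ (by omega) _ _ (fun x hx => hle x (Or.inr (E.htau1 x hx).1)) E.hY1).mul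
      (unit_assign _ _ (by omega) _ _ (fun x hx => hle x (Or.inl (E.hsig1 x hx).1)) E.hX1)
  have hZ : IsUnit (cm _ E.rightFac) := by
    rw [EGFPData.rightFac, map_mul]
    exact (unit_assign _ _ (by omega) _ _ (fun x hx => hle x (Or.inl (E.hsig2 x hx).1)) E.hX2).mul
      (unit_assign _ _ (by omega) _ _ (fun x hx => hle x (Or.inr (E.htau2 x hx).1)) E.hY2)
  have hsig : E.sig = (E.sig.map SIdx.val).map pos := by
    rw [List.map_map]
    conv_lhs => rw [← List.map_id E.sig]
    refine List.map_congr_left fun x hx => ?_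
    have := E.hsigpos x hx
    cases x with
    | pos i => first | rfl | exact absurd this (by simp [SIdx.isNeg])
    | neg i => first | rfl | exact absurd this (by simp [SIdx.isNeg])
  have htau : E.tau = (E.tau.map SIdx.val).map SIdx.neg := by
    rw [List.map_map]
    conv_lhs => rw [← List.map_id E.tau]
    refine List.map_congr_left fun x hx => ?_
    have := E.htauneg x hx
    cases x with
    | pos i => first | rfl | exact absurd this (by simp [SIdx.isNeg])
    | neg i => first | rfl | exact absurd this (by simp [SIdx.isNeg])
  set F : SIdx → PM n := fun i => cm _ (fiedlerX (k + 1) E.A i) with hF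
  have c1 : ∀ i ≤ k, F (pos i) = -cm _ (E.A i) := by
    intro i hi
    simp only [hF, fiedlerX]
    rw [if_neg (by omega), map_neg]
  have c2 : ∀ i, 1 ≤ i → i ≤ k + 1 → F (SIdx.neg i) = cm _ (E.A i) := by
    intro i hi _
    simp only [hF, fiedlerX]
    rw [if_neg (by omega)]
  have c3 : 0 ∈ E.tau.map SIdx.val → F (SIdx.neg 0) * (-cm _ (E.A 0)) = 1 ∧
      (-cm _ (E.A 0)) * F (SIdx.neg 0) = 1 := by
    intro h
    have h1 : SIdx.neg 0 ∈ E.tau := by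
      rw [htau]; exact List.mem_map_of_mem h
    have h2 : IsUnit (-E.A 0).det := (Matrix.isUnit_iff_isUnit_det _).1 (E.hA0 h1).neg
    simp only [hF, fiedlerX, if_true]
    rw [← map_neg, ← map_mul, ← map_mul, Matrix.nonsing_inv_mul _ h2, Matrix.mul_nonsing_inv _ h2,
      map_one]
    exact ⟨rfl, rfl⟩
  have c4 : k + 1 ∈ E.sig.map SIdx.val → F (pos (k + 1)) * cm _ (E.A (k + 1)) = 1 ∧
      cm _ (E.A (k + 1)) * F (pos (k + 1)) = 1 := by
    intro h
    have h1 : SIdx.pos (k + 1) ∈ E.sig := by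
      rw [hsig]; exact List.mem_map_of_mem h
    have h2 : IsUnit (E.A (k + 1)).det := (Matrix.isUnit_iff_isUnit_det _).1 (E.hAmUnit h1)
    simp only [hF, fiedlerX, if_true]
    rw [← map_mul, ← map_mul, Matrix.nonsing_inv_mul _ h2, Matrix.mul_nonsing_inv _ h2,
      map_one]
    exact ⟨rfl, rfl⟩
  have fs : ∀ M : Matrix (Fin (k + 1)) (Fin (k + 1)) (PM n),
      fl (k + 1) n ((Polynomial.X : Polynomial ℂ) • M) = (Polynomial.X : Polynomial ℂ) • fl (k + 1) n M :=
    fun M => rfl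
  have g1 := gfp (Polynomial.X : Polynomial ℂ) k (fun i => cm _ (E.A i)) F _ _ E.hperm c1 c2 c3 c4
  have g2 := gfp_rev (Polynomial.X : Polynomial ℂ) k (fun i => cm _ (E.A i)) F _ _ E.hperm c1 c2 c3 c4
  have hMs : cm _ (prodFiedler (k + 1) n E.A E.sig) = fl (k + 1) n
      ((E.sig.map SIdx.val).map (fun i => eM (k + 1) (pos i) (F (pos i)))).prod := by
    rw [cm_prodFiedler]
    conv_lhs => rw [hsig]
    rw [List.map_map (f := pos)]
    rfl
  have hMt : cm _ (prodFiedler (k + 1) n E.A E.tau) = fl (k + 1) n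
      ((E.tau.map SIdx.val).map (fun i => eM (k + 1) (SIdx.neg i) (F (SIdx.neg i)))).prod := by
    rw [cm_prodFiedler]
    conv_lhs => rw [htau]
    rw [List.map_map (f := SIdx.neg)]
    rfl
  constructor
  · rw [polyP_eq]
    refine lin_of hW hZ (G := (Polynomial.X : Polynomial ℂ) •
      cm _ (prodFiedler (k + 1) n E.A E.tau) - cm _ (prodFiedler (k + 1) n E.A E.sig)) ?_ ?_ g1
    · rw [pencil_eq, EGFPData.L1, EGFPData.L0]
      simp only [map_mul, mul_sub, sub_mul, mul_smul_comm, smul_mul_assoc]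
    · rw [map_sub, fs, hMs, hMt]
  · rw [revPolyP_eq]
    refine lin_of hW hZ (G := cm _ (prodFiedler (k + 1) n E.A E.tau) -
      (Polynomial.X : Polynomial ℂ) • cm _ (prodFiedler (k + 1) n E.A E.sig)) ?_ ?_ g2
    · rw [revPencil_eq, EGFPData.L1, EGFPData.L0]
      simp only [map_mul, mul_sub, sub_mul, mul_smul_comm, smul_mul_assoc]
    · rw [map_sub, fs, hMs, hMt]

end EGFPProof
end EGFPProof

/-- Every EGFP `L(λ)` (with all its matrix assignments nonsingular, as
recorded in `EGFPData`) is a strong linearization of `P(λ)`: `L(λ)` is a linearization of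
`P(λ)` and `rev L(λ)` is a linearization of `rev P(λ)`. -/
theorem egfp_is_strong_linearization {m n : ℕ} (E : EGFPData m n) :
    IsLinearization (pencilPoly E.L1 E.L0) (polyP m n E.A) ∧
    IsLinearization (revPencilPoly E.L1 E.L0) (revPolyP m n E.A) := by
  exact EGFPProof.main_aux E
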